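/- Let G be a finite EPPO-group having a normal subgroup of odd prime order q. Then G is supersolvable. -/

import Mathlib

/-- A group is an EPPO-group if every element has prime power order. -/
def IsEPPOGroup (G : Type*) [Group G] : Prop :=
  ∀ g : G, ∃ (p n : ℕ), p.Prime ∧ orderOf g = p ^ n

/-- A group is supersolvable if it has a chain of subgroups from `⊥` to `⊤`,
each normal in the whole group, with all successive quotients cyclic. -/
def IsSupersolvable (G : Type*) [Group G] : Prop :=
  ∃ (n : ℕ) (s : Fin (n + 1) → Subgroup G) (hnorm : ∀ i, (s i).Normal),
    Monotone s ∧ s 0 = ⊥ ∧ s (Fin.last n) = ⊤ ∧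
    ∀ i : Fin n,
      haveI := hnorm i.castSucc
      IsCyclic (s i.succ ⧸ (s i.castSucc).subgroupOf (s i.succ))

inductive NChain (G : Type*) [Group G] : Subgroup G → Prop
  | top : NChain G ⊤
  | step (K L : Subgroup G) (hK : K.Normal) (hL : L.Normal) (hKL : K ≤ L)
      (hc : IsCyclic (L ⧸ K.subgroupOf L)) (h : NChain G L) : NChain G K

theorem NChain.exists_chain {G : Type*} [Group G] {K : Subgroup G} (h : NChain G K) :
  ∃ (n : ℕ) (s : Fin (n + 1) → Subgroup G) (hnorm : ∀ i, (s i).Normal),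
    Monotone s ∧ s 0 = K ∧ s (Fin.last n) = ⊤ ∧
    ∀ i : Fin n,
      haveI := hnorm i.castSucc
      IsCyclic (s i.succ ⧸ (s i.castSucc).subgroupOf (s i.succ)) := by
  induction h with
  | top => exact ⟨0, fun _ => ⊤, fun _ => inferInstance, fun _ _ _ => le_rfl, rfl, rfl,
      fun i => i.elim0⟩
  | step K L hK hL hKL hc h ih =>
    obtain ⟨n, s, hn, hm, h0, hl, hq⟩ := ih
    subst h0
    refine ⟨n + 1, Fin.cons K s, ?_, ?_, rfl, ?_, ?_⟩
    · intro i
      refine Fin.cases ?_ ?_ i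
      · exact hK
      · exact hn
    · refine Fin.monotone_iff_le_succ.2 ?_
      intro i
      refine Fin.cases ?_ ?_ i
      · exact hKL
      · intro j
        exact hm (Fin.castSucc_le_succ j)
    · exact hl
    · intro i
      refine Fin.cases ?_ ?_ i
      · exact hc
      · intro j
        exact hq j

theorem end_eigen {q : ℕ} [Fact q.Prime] {M : Type*} [AddCommGroup M] [Module (ZMod q) M]
    [Finite M] [Nontrivial M] (T : Module.End (ZMod q) M) (hT : T ^ (q - 1) = 1) :
    ∃ (v : M) (a : ZMod q), v ≠ 0 ∧ T v = a • v := by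
  have hp : q.Prime := Fact.out
  have hfd : Module.Finite (ZMod q) M := Module.Finite.of_finite
  have hdvd : minpoly (ZMod q) T ∣ Polynomial.X ^ q - Polynomial.X := by
    apply minpoly.dvd
    have : T ^ q = T := by
      have h := pow_succ T (q - 1)
      rw [hT, one_mul, Nat.sub_add_cancel hp.one_le] at h
      exact h
    simp [this]
  have hint : IsIntegral (ZMod q) T := Algebra.IsIntegral.isIntegral T
  have hdeg := minpoly.degree_pos hint
  have hspl : (Polynomial.X ^ q - Polynomial.X : Polynomial (ZMod q)).Splits := by
    have h1 := FiniteField.splits_X_pow_nat_card_sub_X (K := ZMod q) (p := q)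
    simpa using h1
  have hne0 := FiniteField.X_pow_card_sub_X_ne_zero (ZMod q) hp.one_lt
  obtain ⟨a, ha⟩ := (hspl.of_dvd hne0 hdvd).exists_eval_eq_zero hdeg.ne'
  obtain ⟨v, hv⟩ := (Module.End.hasEigenvalue_of_isRoot (f := T) ha).exists_hasEigenvector
  exact ⟨v, a, hv.2, hv.apply_eq_smul⟩

theorem hom_eigen {q : ℕ} [Fact q.Prime] {A : Type*} [CommGroup A] [Finite A] [Nontrivial A]
    (hA : ∀ x : A, x ^ q = 1) (f : A →* A) (hf : ∀ x, f^[q - 1] x = x) :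
    ∃ (v : A) (k : ℕ), v ≠ 1 ∧ f v = v ^ k := by
  let _ : Module (ZMod q) (Additive A) := AddCommGroup.zmodModule (n := q) (fun x => hA x.toMul)
  let T : Module.End (ZMod q) (Additive A) := (MonoidHom.toAdditive f).toZModLinearMap q
  obtain ⟨v, a, hv, he⟩ := end_eigen T (by
    ext v
    rw [Module.End.pow_apply]
    exact hf v.toMul)
  refine ⟨v.toMul, a.val, hv, ?_⟩
  have : a • v = a.val • v := by
    conv_lhs => rw [← ZMod.natCast_zmod_val a]
    exact Nat.cast_smul_eq_nsmul _ _ _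
  rw [this] at he
  exact he

theorem exists_cyclic_normal {G : Type*} [Group G] [Finite G] {q : ℕ} [Fact q.Prime]
    (C : Subgroup G) [C.Normal] (hC : IsPGroup q C) (hne : C ≠ ⊥) (g : G)
    (hg : g ^ (q - 1) ∈ C) (hgen : ∀ x : G, ∃ k : ℤ, g ^ k * x ∈ C) :
    ∃ L : Subgroup G, L.Normal ∧ L ≤ C ∧ L ≠ ⊥ ∧ IsCyclic L := by
  have hp : q.Prime := Fact.out
  let V : Subgroup G :=
    { carrier := {x | x ∈ C ∧ (∀ c ∈ C, c * x = x * c) ∧ x ^ q = 1}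
      one_mem' := ⟨one_mem _, by simp, by simp⟩
      mul_mem' := by
        rintro a b ⟨ha, ha', ha''⟩ ⟨hb, hb', hb''⟩
        refine ⟨mul_mem ha hb, fun c hc => ?_, ?_⟩
        · rw [← mul_assoc, ha' c hc, mul_assoc, hb' c hc, mul_assoc]
        · have : Commute a b := hb' a ha
          rw [this.mul_pow, ha'', hb'', one_mul]
      inv_mem' := by
        rintro a ⟨ha, ha', ha''⟩
        refine ⟨inv_mem ha, fun c hc => ?_, by simp [ha'']⟩
        have : Commute c a := ha' c hc
        exact this.inv_right }
  have hV : V.Normal := by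
    constructor
    rintro x ⟨hx, hx', hx''⟩ y
    refine ⟨‹C.Normal›.conj_mem x hx y, fun c hc => ?_, by rw [conj_pow, hx'']; simp⟩
    have := hx' (y⁻¹ * c * y) (by simpa using ‹C.Normal›.conj_mem c hc y⁻¹)
    calc c * (y * x * y⁻¹) = y * ((y⁻¹ * c * y) * x) * y⁻¹ := by group
      _ = _ := by rw [this]; group
  have hVne : Nontrivial V := by
    have : Nontrivial C := (Subgroup.nontrivial_iff_ne_bot C).2 hne
    have hz := hC.center_nontrivial
    have hzp : IsPGroup q (Subgroup.center C) := hC.to_subgroup _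
    obtain ⟨n, hn, hcard⟩ := (hzp.nontrivial_iff_card).1 hz
    obtain ⟨z, hz⟩ := exists_prime_orderOf_dvd_card' (G := Subgroup.center C) q
      (by rw [hcard]; exact dvd_pow_self _ hn.ne')
    have hzq : z ^ q = 1 := hz ▸ pow_orderOf_eq_one z
    refine ⟨⟨⟨((z : C) : G), (z : C).2, fun c hc => ?_, ?_⟩, 1, fun h => ?_⟩⟩
    · have := Subgroup.mem_center_iff.1 z.2 ⟨c, hc⟩
      exact congrArg Subtype.val this
    · have := congrArg (fun t : Subgroup.center C => ((t : C) : G)) hzq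
      simpa using this
    · have h1 : z = 1 := by
        have := congrArg Subtype.val h
        ext; simpa using this
      rw [h1, orderOf_one] at hz
      exact hp.one_lt.ne hz
  let _ : CommGroup V :=
    { (inferInstance : Group V) with
      mul_comm := fun a b => Subtype.ext (b.2.2.1 a a.2.1) }
  let f : V →* V := (MulAut.conjNormal g : MulAut V).toMonoidHom
  have hTv : ∀ v : V, ((f v : V) : G) = g * (v : G) * g⁻¹ :=
    fun v => MulAut.conjNormal_apply g v
  have hTn : ∀ (n : ℕ) (v : V), ((f^[n] v : V) : G) = g ^ n * (v : G) * (g ^ n)⁻¹ := by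
    intro n v
    induction n with
    | zero => simp
    | succ n ih => rw [Function.iterate_succ_apply', hTv, ih, pow_succ']; group
  obtain ⟨v, a, hvne, hve⟩ := hom_eigen (q := q) (A := V) (fun x => Subtype.ext x.2.2.2) f (by
    intro v
    apply Subtype.ext
    rw [hTn, v.2.2.1 _ hg]
    simp)
  obtain ⟨w, hwV⟩ := v
  have hgw : g * w * g⁻¹ = w ^ a := by
    rw [← hTv ⟨w, hwV⟩, hve]
    rfl
  refine ⟨Subgroup.zpowers w, ?_, ?_, ?_, inferInstance⟩
  · have hgn : g ∈ Subgroup.normalizer (Subgroup.zpowers w : Set G) := by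
      have hm : (Subgroup.zpowers w).map (MulAut.conj g).toMonoidHom ≤ Subgroup.zpowers w := by
        rw [MonoidHom.map_zpowers, Subgroup.zpowers_le]
        change g * w * g⁻¹ ∈ _
        rw [hgw]; exact Subgroup.npow_mem_zpowers w _
      have hm' := Subgroup.eq_of_le_of_card_ge hm
        (Subgroup.card_map_of_injective (MulAut.conj g).injective).ge
      rw [Subgroup.mem_normalizer_iff]
      intro h
      constructor
      · intro hh
        exact hm ⟨h, hh, rfl⟩
      · intro hh
        rw [← hm'] at hh
        obtain ⟨h', hh', he⟩ := hh
        have : h' = h := (MulAut.conj g).injective he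
        rwa [← this]
    have hCn : C ≤ Subgroup.normalizer (Subgroup.zpowers w : Set G) := by
      intro c hc
      rw [Subgroup.mem_normalizer_iff]
      intro h
      have key : ∀ d ∈ C, ∀ h ∈ Subgroup.zpowers w, d * h * d⁻¹ = h := by
        intro d hd h hh
        have : h ∈ V := (Subgroup.zpowers_le.2 hwV) hh
        rw [this.2.1 d hd]; group
      constructor
      · intro hh; rwa [key c hc h hh]
      · intro hh
        have := key c⁻¹ (inv_mem hc) _ hh
        have h2 : h = c * h * c⁻¹ := by
          rw [← this]; group
        rwa [h2]
    rw [← Subgroup.normalizer_eq_top_iff, eq_top_iff]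
    intro x _
    obtain ⟨k, hk⟩ := hgen x
    have := mul_mem (inv_mem (zpow_mem hgn k)) (hCn hk)
    simpa using this
  · exact Subgroup.zpowers_le.2 hwV.1
  · intro h
    rw [Subgroup.zpowers_eq_bot] at h
    exact hvne (Subtype.ext h)

theorem cyclic_of_map {G : Type*} [Group G] (K L : Subgroup G) [K.Normal]
    (M : Subgroup (G ⧸ K)) (hM : IsCyclic M) (hL : ∀ x ∈ L, (x : G ⧸ K) ∈ M) :
    IsCyclic (L ⧸ K.subgroupOf L) := by
  let φ : L →* M := ((QuotientGroup.mk' K).comp L.subtype).codRestrict M (fun x => hL x x.2)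
  have hk : K.subgroupOf L = φ.ker := by
    ext x
    rw [Subgroup.mem_subgroupOf, MonoidHom.mem_ker, ← QuotientGroup.eq_one_iff]
    exact (Subtype.ext_iff (a1 := φ x) (a2 := 1)).symm
  have h2 : IsCyclic (L ⧸ φ.ker) :=
    isCyclic_of_injective (QuotientGroup.kerLift φ) (QuotientGroup.kerLift_injective φ)
  exact isCyclic_of_injective (QuotientGroup.quotientMulEquivOfEq hk).toMonoidHom
    (QuotientGroup.quotientMulEquivOfEq hk).injective

theorem nchain_aux {G : Type*} [Group G] [Finite G] {q : ℕ} [Fact q.Prime]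
    (C : Subgroup G) [C.Normal] (hC : IsPGroup q C) (g : G)
    (hg : g ^ (q - 1) ∈ C) (hgen : ∀ x : G, ∃ k : ℤ, g ^ k * x ∈ C)
    (K : Subgroup G) (hK : K.Normal) (hKC : K ≤ C) : NChain G K := by
  induction K using WellFoundedGT.induction with
  | ind K ih =>
  by_cases h : K = C
  · subst h
    refine NChain.step K ⊤ hK inferInstance le_top ?_ NChain.top
    refine cyclic_of_map K ⊤ (Subgroup.zpowers (g : G ⧸ K)) inferInstance ?_
    intro x _
    obtain ⟨k, hk⟩ := hgen x
    rw [← QuotientGroup.eq_one_iff, QuotientGroup.mk_mul, QuotientGroup.mk_zpow] at hk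
    rw [eq_inv_of_mul_eq_one_right hk]
    exact inv_mem (Subgroup.zpow_mem_zpowers _ k)
  · have hCn : (C.map (QuotientGroup.mk' K)).Normal :=
      Subgroup.Normal.map ‹_› _ (QuotientGroup.mk'_surjective K)
    obtain ⟨M, hMn, hMC, hMne, hMc⟩ := exists_cyclic_normal (q := q) (C.map (QuotientGroup.mk' K))
      (hC.map _) (by
        intro hb
        rw [Subgroup.map_eq_bot_iff, QuotientGroup.ker_mk'] at hb
        exact h (le_antisymm hKC hb)) (g : G ⧸ K) ⟨_, hg, rfl⟩ (by
        intro x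
        obtain ⟨x, rfl⟩ := QuotientGroup.mk_surjective x
        obtain ⟨k, hk⟩ := hgen x
        exact ⟨k, _, hk, rfl⟩)
    have hle : K ≤ M.comap (QuotientGroup.mk' K) := by
      intro x hx
      rw [Subgroup.mem_comap, QuotientGroup.mk'_apply, (QuotientGroup.eq_one_iff x).2 hx]
      exact one_mem _
    refine NChain.step K (M.comap (QuotientGroup.mk' K)) hK (hMn.comap _) hle
      (cyclic_of_map K _ M hMc fun x hx => hx) (ih _ (lt_of_le_of_ne hle ?_) (hMn.comap _) ?_)
    · intro he
      apply hMne
      rw [← Subgroup.map_comap_eq_self_of_surjective (QuotientGroup.mk'_surjective K) M, ← he,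
        Subgroup.map_eq_bot_iff, QuotientGroup.ker_mk']
    · intro x hx
      obtain ⟨c, hc, he⟩ := hMC hx
      have := QuotientGroup.eq.1 he
      have := mul_mem hc (hKC this)
      simpa using this

theorem EPPO_normal_subgroup_odd_prime_order_supersolvable {G : Type*} [Group G] [Finite G]
    (hG : IsEPPOGroup G) {q : ℕ} (hq : q.Prime) (hodd : Odd q)
    (N : Subgroup G) [N.Normal] (hN : Nat.card N = q) :
    IsSupersolvable G := by
  have : Fact q.Prime := ⟨hq⟩
  have hNc : IsCyclic N := isCyclic_of_prime_card hN
  subst hN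
  let φ : G →* (ZMod (Nat.card N))ˣ :=
    (IsCyclic.mulAutMulEquiv N).toMonoidHom.comp MulAut.conjNormal
  have hker : ∀ x ∈ φ.ker, ∀ n ∈ N, x * n = n * x := by
    intro x hx n hn
    have h1 : (MulAut.conjNormal x : MulAut N) = 1 := by
      apply (IsCyclic.mulAutMulEquiv N).injective
      rw [map_one]; exact hx
    have h2 := MulAut.conjNormal_apply x (⟨n, hn⟩ : N)
    rw [h1] at h2
    have h3 : n = x * n * x⁻¹ := h2
    exact (eq_mul_inv_iff_mul_eq.1 h3).symm
  obtain ⟨n, hn⟩ := exists_prime_orderOf_dvd_card' (G := N) (Nat.card N) dvd_rfl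
  have hC : IsPGroup (Nat.card N) φ.ker := by
    intro x
    obtain ⟨p, k, hp, hk⟩ := hG x
    by_cases hpq : p = Nat.card N
    · refine ⟨k, ?_⟩
      rw [hpq] at hk
      apply Subtype.ext
      have h := pow_orderOf_eq_one (x : G)
      rw [hk] at h
      exact h
    · have hno : orderOf (n : G) = Nat.card N := by rw [Subgroup.orderOf_coe, hn]
      have hco : (orderOf (x : G)).Coprime (orderOf (n : G)) := by
        rw [hk, hno]
        exact Nat.Coprime.pow_left _ ((Nat.coprime_primes hp hq).2 hpq)
      have hmul := Commute.orderOf_mul_eq_mul_orderOf_of_coprime (hker x x.2 n n.2) hco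
      obtain ⟨r, j, hr, hj⟩ := hG (x * n)
      rw [hj, hk, hno] at hmul
      have h1 : Nat.card N = r := (Nat.prime_dvd_prime_iff_eq hq hr).1
        (hq.dvd_of_dvd_pow (hmul ▸ dvd_mul_left _ _))
      have hk0 : k = 0 := by
        by_contra hk0
        have : p = r := (Nat.prime_dvd_prime_iff_eq hp hr).1
          (hp.dvd_of_dvd_pow (hmul ▸ (dvd_pow_self p hk0).mul_right _))
        exact hpq (this.trans h1.symm)
      refine ⟨0, ?_⟩
      rw [hk0, pow_zero, orderOf_eq_one_iff] at hk
      simpa using hk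
  obtain ⟨⟨_, g, rfl⟩, hgen⟩ := IsCyclic.exists_generator (α := φ.range)
  refine (nchain_aux φ.ker hC g ?_ ?_ ⊥ inferInstance bot_le).exists_chain
  · rw [MonoidHom.mem_ker, map_pow]
    exact ZMod.units_pow_card_sub_one_eq_one _ _
  · intro x
    obtain ⟨k, hk⟩ := Subgroup.mem_zpowers_iff.1 (hgen ⟨φ x, x, rfl⟩)
    have hk' : φ g ^ k = φ x := congrArg Subtype.val hk
    refine ⟨-k, ?_⟩
    rw [MonoidHom.mem_ker, map_mul, map_zpow, ← hk', ← zpow_add]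
    simp
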